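/- arXiv:1802.01220 — 3 statements merged into one kernel-verified Lean document; each statement's English description precedes it below -/
import Mathlib

section
/- Let Δ be an object system and ρ a τ-loop, i.e., a cyclic path all of whose transitions are internal τ-transitions. Then every transition on ρ is a stutter step, i.e., every transition s →τ r on ρ satisfies s ≡ r. -/
namespace EffectPaper

open scoped Classical

/-- Visible events: thread-indexed call and return actions:
`call t m v` stands for `(t, call, m(v))` and `ret t m v` for `(t, ret(v), m)`. -/
inductive Ev (T M V : Type) : Type
  | call : T → M → V → Ev T M V
  | ret  : T → M → V → Ev T M V

/-- Actions: a visible event or the silent action `τ`, encoded as `none`. -/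
abbrev Act (T M V : Type) := Option (Ev T M V)

/-- An object system: a labelled transition system with an initial state. -/
structure ObjSys (S T M V : Type) where
  tr : S → Act T M V → S → Prop
  init : S

variable {S T M V : Type}

/-- The thread of an event. -/
def evThread : Ev T M V → T
  | .call t _ _ => t
  | .ret t _ _ => t

/-- Whether an event is a call action. -/
def isCall : Ev T M V → Bool
  | .call _ _ _ => true
  | .ret _ _ _ => false

/-- The sequence of call actions of a history. -/
def callsOf (H : List (Ev T M V)) : List (Ev T M V) := H.filter isCall

/-- Projection of a history onto the events of one thread. -/
noncomputable def threadProj (t : T) : List (Ev T M V) → List (Ev T M V)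
  | [] => []
  | e :: rest => if evThread e = t then e :: threadProj t rest else threadProj t rest

/-- Sequences in which call and return actions alternate,
each call being immediately followed by a matching return. -/
inductive AltCR : List (Ev T M V) → Prop
  | nil : AltCR []
  | cons (t m v t' m' v') {rest : List (Ev T M V)} (h : AltCR rest) :
      AltCR (Ev.call t m v :: Ev.ret t' m' v' :: rest)

/-- A history is completed if it has no pending call: for each thread the
projection onto that thread alternates calls and matching returns. -/
def Completed (H : List (Ev T M V)) : Prop := ∀ t : T, AltCR (threadProj t H)

/-- The trace (sequence of visible actions) obtained from a path by omitting
states and `τ`-actions; for an execution this is also its history `H(σ)`. -/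
def traceOf (l : List (Act T M V × S)) : List (Ev T M V) := l.filterMap Prod.fst

/-- The last state of a path starting at `s` whose steps are `l`. -/
def endStateFrom (s : S) (l : List (Act T M V × S)) : S :=
  (l.getLast?.map Prod.snd).getD s

/-- The states lying on a path starting at `s` whose steps are `l`. -/
def pathStates (s : S) (l : List (Act T M V × S)) : List S := s :: l.map Prod.snd

/-- `τ`-stutter compression of an alternating sequence of entry-sets and actions
(with leading entry `X`): every maximal subsequence of consecutive entries joined
by `τ`-actions and having pairwise equal entry-sets is collapsed to a single entry. -/
noncomputable def compress (X : Set S) :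
    List (Act T M V × Set S) → List (Act T M V × Set S)
  | [] => []
  | (a, Y) :: rest =>
      if a = (none : Act T M V) ∧ X = Y then compress X rest
      else (a, Y) :: compress Y rest

namespace ObjSys

variable (Δ : ObjSys S T M V)

/-- `Δ.IsPath s l` : `l` is (the list of steps of) a finite path of `Δ` from `s`. -/
inductive IsPath : S → List (Act T M V × S) → Prop
  | nil (s : S) : IsPath s []
  | cons {s s' : S} {a : Act T M V} {l : List (Act T M V × S)}
      (h : Δ.tr s a s') (hl : IsPath s' l) : IsPath s ((a, s') :: l)

/-- The set of `k`-traces of a state, by strong recursion on `k`.  A `k`-trace of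
`s` is represented by the entry-set of `s` together with the `τ`-stutter-compressed
alternating list of actions and entry-sets along a path from `s`, where the entry
representing `T^k(x)` is the `≡_k`-class `{y | ∀ k' < k, kTraces k' x = kTraces k' y}`. -/
noncomputable def kTraces : ℕ → S → Set (Set S × List (Act T M V × Set S))
  | k => fun s =>
      { tt | ∃ l, Δ.IsPath s l ∧
          tt = (({ y | ∀ k' < k, kTraces k' s = kTraces k' y } : Set S),
            compress { y | ∀ k' < k, kTraces k' s = kTraces k' y }
              (l.map fun p =>
                (p.1, ({ y | ∀ k' < k, kTraces k' p.2 = kTraces k' y } : Set S)))) }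
  termination_by k => k

/-- `k`-trace equivalence `s ≡_k r`, i.e. `T^k(s) = T^k(r)`. -/
def equivK (k : ℕ) (s r : S) : Prop := ∀ k' < k, Δ.kTraces k' s = Δ.kTraces k' r

/-- The `≡_k`-class of a state (the representation of `T^k(x)`). -/
def clsK (k : ℕ) (x : S) : Set S := { y | Δ.equivK k x y }

/-- Max-trace (effect) equivalence `s ≡ r`: `s ≡_k r` for all `k`. -/
def Equiv (s r : S) : Prop := ∀ k, Δ.kTraces k s = Δ.kTraces k r

/-- The effect state `[s]_≡` of a state. -/
def eqClass (s : S) : Set S := { r | Δ.Equiv s r }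

/-- `c` is an effect state. -/
def IsEffState (c : Set S) : Prop := ∃ s, c = Δ.eqClass s

/-- The `k`-trace obtained from the path from `s` with steps `l`. -/
noncomputable def kTraceOf (k : ℕ) (s : S) (l : List (Act T M V × S)) :
    Set S × List (Act T M V × Set S) :=
  (Δ.clsK k s, compress (Δ.clsK k s) (l.map fun p => (p.1, Δ.clsK k p.2)))

/-- Effect stutter equivalence `σ ≃ ρ` of paths: they are `k`-trace stutter
equivalent for every `k > 0`. -/
def StutterEquiv (s : S) (σ : List (Act T M V × S)) (r : S)
    (ρ : List (Act T M V × S)) : Prop :=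
  ∀ k, 0 < k → Δ.kTraceOf k s σ = Δ.kTraceOf k r ρ

/-- The set `E(σ)` of effect states on a path. -/
def effStatesOfPath (s : S) (l : List (Act T M V × S)) : Set (Set S) :=
  { c | ∃ x ∈ pathStates s l, c = Δ.eqClass x }

/-- Zero or more `τ`-steps, `s ⇒τ r`. -/
def tauMany : S → S → Prop := Relation.ReflTransGen fun x y => Δ.tr x none y

/-- `τ`-steps passing only through `≡`-equivalent (stutter) states. -/
def stutterTau : S → S → Prop :=
  Relation.ReflTransGen fun x y => Δ.tr x none y ∧ Δ.Equiv x y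

/-- The weak step `s ⇒a r` (`⇒τ →a ⇒τ` for visible `a`, `⇒τ` for `a = τ`). -/
def weak (a : Act T M V) (x y : S) : Prop :=
  match a with
  | none => Δ.tauMany x y
  | some e => ∃ u v, Δ.tauMany x u ∧ Δ.tr u (some e) v ∧ Δ.tauMany v y

/-- `ES(s, a, r)` : there is an effect step from `s` via `a` to `r`, i.e. a path
`s = s₁ →τ ⋯ →τ sₙ →a r` with `s₁ ≡ ⋯ ≡ sₙ ≢ r`. -/
def IsEffStep (s : S) (a : Act T M V) (r : S) : Prop :=
  ∃ sn, Δ.stutterTau s sn ∧ Δ.tr sn a r ∧ ¬ Δ.Equiv sn r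

/-- The effect steps `ES(s,τ,r)` and `ES(s,a,q)` form a branch unit. -/
def BranchUnit (s r : S) (a : Act T M V) (q : S) : Prop :=
  Δ.IsEffStep s none r ∧ Δ.IsEffStep s a q ∧ ¬ Δ.Equiv q r

/-- The internal effect step `ES(s,τ,r)` is identified by the effect step `ES(s,a,q)`. -/
def IdentifiedBy (s r : S) (a : Act T M V) (q : S) : Prop :=
  Δ.BranchUnit s r a q ∧ ∀ l, Δ.IsEffStep r a l → ¬ Δ.Equiv l q

/-- `ES(s,τ,r)` is independent of `ES(s,a,q)` with respect to the effect state `c`. -/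
def IndependentAt (s r : S) (a : Act T M V) (q : S) (c : Set S) : Prop :=
  (∃ l₁ l₂, Δ.weak a r l₁ ∧ Δ.tauMany q l₂ ∧ l₁ ∈ c ∧ l₂ ∈ c) ∨
    (a = none ∧ ∃ l₂, Δ.tauMany q l₂ ∧ Δ.Equiv l₂ r)

/-- The effect race relation `ES(s,τ,r) ≪ ES(s,a,q)`: `ES(s,τ,r)` is identified by
`ES(s,a,q)` and is dependent of it w.r.t. every effect state. -/
def Race (s r : S) (a : Act T M V) (q : S) : Prop :=
  Δ.IdentifiedBy s r a q ∧ ∀ c, Δ.IsEffState c → ¬ Δ.IndependentAt s r a q c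

/-- The last state of an execution prefix (an execution starts at `Δ.init`). -/
def endState (l : List (Act T M V × S)) : S := endStateFrom Δ.init l

/-- A concrete effect-step segment from `s` via `a` to `r`. -/
def IsEffSeg (s : S) (a : Act T M V) (r : S) (seg : List (Act T M V × S)) : Prop :=
  Δ.IsPath s seg ∧ seg.getLast? = some (a, r) ∧
    (∀ p ∈ seg.dropLast, p.1 = (none : Act T M V) ∧ Δ.Equiv s p.2) ∧
    ¬ Δ.Equiv s r

/-- `ES(s,a,r)^σ` : the execution `σ` passes through an effect step `ES(s,a,r)`. -/
def PassesThrough (σ : List (Act T M V × S)) (s : S) (a : Act T M V) (r : S) : Prop :=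
  ∃ pre seg post, σ = pre ++ seg ++ post ∧ Δ.endState pre = s ∧ Δ.IsEffSeg s a r seg

/-- The race structure `RaceStr(s, r, s')`: the executions passing through
`ES(s,τ,r)` together with those passing through `ES(s,τ,s')`. -/
def RaceStrAt (s r s' : S) : Set (List (Act T M V × S)) :=
  { σ | Δ.IsPath Δ.init σ ∧
      (Δ.PassesThrough σ s none r ∨ Δ.PassesThrough σ s none s') }

/-- `R` is a race structure of `Δ`. -/
def IsRaceStr (R : Set (List (Act T M V × S))) : Prop :=
  ∃ s r s', Δ.Race s r none s' ∧ R = Δ.RaceStrAt s r s'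

/-- `RaceStr(Δ)` : the union of all race structures of `Δ`. -/
def raceStrAll : Set (List (Act T M V × S)) :=
  { σ | ∃ R, Δ.IsRaceStr R ∧ σ ∈ R }

end ObjSys

/-- `σ(y/x)` : the execution `σ` with the state `x` replaced by `y`. -/
noncomputable def replaceSt (σ : List (Act T M V × S)) (x y : S) :
    List (Act T M V × S) :=
  σ.map fun p => (p.1, if p.2 = x then y else p.2)

namespace ObjSys

variable (Δ : ObjSys S T M V)

/-- Effect structures `Estr(s, r)` (inductively): (1) a race structure of
`ES(s,τ,r) ≪ ES(s,τ,s')`; (2) extension by an independent earlier step. -/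
inductive IsEstr : S → S → Set (List (Act T M V × S)) → Prop
  | base {s r s' : S} (h : Δ.Race s r none s') :
      IsEstr s r (Δ.RaceStrAt s r s')
  | step {sp rp s r s' : S} {ap a : Act T M V} {E : Set (List (Act T M V × S))}
      {σ ρ : List (Act T M V × S)}
      (hE : IsEstr s r E) (hσ : σ ∈ E) (hρ : ρ ∈ E)
      (h1 : Δ.PassesThrough σ s none r)
      (h2 : Δ.PassesThrough ρ s a s')
      (h3 : Δ.PassesThrough ρ sp ap s)
      (h4 : Δ.IdentifiedBy sp rp a s)
      (h5 : Δ.IndependentAt sp rp a s (Δ.eqClass r)) :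
      IsEstr sp rp (insert (replaceSt σ s rp) E)

/-- The subsystem induced by a set `E` of executions: its transitions are the
transitions occurring in `E`; equivalences in the subsystem are computed with
respect to these transitions. -/
def restrict (E : Set (List (Act T M V × S))) : ObjSys S T M V where
  tr := fun x a y =>
    ∃ σ ∈ E, ∃ pre post, σ = pre ++ (a, y) :: post ∧ Δ.endState pre = x
  init := Δ.init

/-- The states occurring in a set of executions. -/
def statesIn (E : Set (List (Act T M V × S))) : Set S :=
  { x | ∃ σ ∈ E, x ∈ pathStates Δ.init σ }

/-- The effect states occurring in a set of executions (classes come from `Δ`). -/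
def effStatesIn (E : Set (List (Act T M V × S))) : Set (Set S) :=
  { c | ∃ x ∈ Δ.statesIn E, c = Δ.eqClass x }

/-- `H` is a completed concurrent history of `Δ`. -/
def IsCHistory (H : List (Ev T M V)) : Prop :=
  Completed H ∧ ∃ σ, Δ.IsPath Δ.init σ ∧ traceOf σ = H

/-- The subsystem `Δ(H₁H₂)`: all executions of `Δ` with history `H₁` or `H₂`. -/
def subHH (H₁ H₂ : List (Ev T M V)) : Set (List (Act T M V × S)) :=
  { σ | Δ.IsPath Δ.init σ ∧ (traceOf σ = H₁ ∨ traceOf σ = H₂) }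

/-- `c₁ ≪_s c₂` : effect race instructions from `s`, given an instruction
labelling `ℓ` of the transitions. -/
def InstrRace {C : Type} (ℓ : S → Act T M V → S → C) (s : S) (c₁ c₂ : C) : Prop :=
  ∃ r a q sn sm,
    Δ.stutterTau s sn ∧ Δ.tr sn none r ∧ ¬ Δ.Equiv sn r ∧ ℓ sn none r = c₁ ∧
    Δ.stutterTau s sm ∧ Δ.tr sm a q ∧ ¬ Δ.Equiv sm q ∧ ℓ sm a q = c₂ ∧
    Δ.Race s r a q

/-- Branching bisimulations on an object system. -/
def IsBranchingBisim (R : S → S → Prop) : Prop :=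
  Symmetric R ∧ ∀ s₁ s₂, R s₁ s₂ →
    (∀ (e : Ev T M V) (s₁' : S), Δ.tr s₁ (some e) s₁' →
      ∃ s₂', Δ.tr s₂ (some e) s₂' ∧ R s₁' s₂') ∧
    (∀ s₁', Δ.tr s₁ none s₁' →
      (R s₁' s₂ ∨ ∃ l s₂',
        Relation.ReflTransGen (fun x y => Δ.tr x none y ∧ R s₁ y) s₂ l ∧
        Δ.tr l none s₂' ∧ R s₁' s₂'))

/-- Branching bisimilarity `s ≈ r`. -/
def Bisim (s r : S) : Prop := ∃ R, Δ.IsBranchingBisim R ∧ R s r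

/-- The class `[s]_≈`. -/
def bClass (s : S) : Set S := { r | Δ.Bisim s r }

/-- The transition relation of the quotient system `Δ/≈`. -/
def qtr (X : Set S) (a : Act T M V) (Y : Set S) : Prop :=
  ∃ u u', X = Δ.bClass u ∧ Y = Δ.bClass u' ∧ Δ.tr u a u' ∧
    (a = none → ¬ Δ.Bisim u u')

end ObjSys

theorem endStateFrom_cons (s : S) (p : Act T M V × S) (l : List (Act T M V × S)) :
    endStateFrom s (p :: l) = endStateFrom p.2 l := by
  cases l <;> simp [endStateFrom, List.getLast?_cons]

theorem endStateFrom_append (s : S) (l₁ l₂ : List (Act T M V × S)) :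
    endStateFrom s (l₁ ++ l₂) = endStateFrom (endStateFrom s l₁) l₂ := by
  induction l₁ generalizing s with
  | nil => rfl
  | cons p l ih => simp only [List.cons_append, endStateFrom_cons, ih]

theorem endStateFrom_eq_getLast (s : S) {l : List (Act T M V × S)} (hne : l ≠ []) :
    endStateFrom s l = (l.getLast hne).2 := by
  simp [endStateFrom, List.getLast?_eq_some_getLast hne]

namespace ObjSys

variable {Δ : ObjSys S T M V}

theorem IsPath.of_append {s : S} {l₁ l₂ : List (Act T M V × S)} (h : Δ.IsPath s (l₁ ++ l₂)) :
    Δ.IsPath s l₁ ∧ Δ.IsPath (endStateFrom s l₁) l₂ := by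
  induction l₁ generalizing s with
  | nil => exact ⟨.nil s, h⟩
  | cons p l ih =>
    cases h with
    | cons h hl =>
      rw [endStateFrom_cons]
      exact ⟨.cons h (ih hl).1, (ih hl).2⟩

theorem IsPath.tauMany {s : S} {l : List (Act T M V × S)} (h : Δ.IsPath s l)
    (htau : ∀ p ∈ l, p.1 = none) : Δ.tauMany s (endStateFrom s l) := by
  induction h with
  | nil s => exact .refl
  | cons h hl ih =>
    obtain rfl := htau _ List.mem_cons_self
    rw [endStateFrom_cons]
    exact .head h (ih fun p hp => htau p (List.mem_cons_of_mem _ hp))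

theorem mem_kTraces {k : ℕ} {s : S} {t : Set S × List (Act T M V × Set S)} :
    t ∈ Δ.kTraces k s ↔ ∃ l, Δ.IsPath s l ∧ t = Δ.kTraceOf k s l := by
  rw [kTraces]
  rfl

theorem clsK_eq_of_equivK {k : ℕ} {x y : S} (h : Δ.equivK k x y) :
    Δ.clsK k x = Δ.clsK k y := by
  ext z
  exact ⟨fun hz k' hk => (h k' hk).symm.trans (hz k' hk),
    fun hz k' hk => (h k' hk).trans (hz k' hk)⟩

theorem kTraces_subset_of_tr {k : ℕ} {x y : S} (htr : Δ.tr x none y) (h : Δ.equivK k x y) :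
    Δ.kTraces k y ⊆ Δ.kTraces k x := by
  intro t ht
  obtain ⟨l, hl, rfl⟩ := mem_kTraces.1 ht
  refine mem_kTraces.2 ⟨(none, y) :: l, .cons htr hl, ?_⟩
  simp [kTraceOf, compress, clsK_eq_of_equivK h]

theorem kTraces_subset_of_tauMany {k : ℕ}
    (hk : ∀ x y, Δ.tauMany x y → Δ.tauMany y x → Δ.equivK k x y)
    {u v : S} (huv : Δ.tauMany u v) (hvu : Δ.tauMany v u) :
    Δ.kTraces k v ⊆ Δ.kTraces k u := by
  induction huv using Relation.ReflTransGen.head_induction_on with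
  | refl => exact subset_rfl
  | head h hwv ih =>
    exact (ih (hvu.tail h)).trans
      (kTraces_subset_of_tr h (hk _ _ (.single h) (hwv.trans hvu)))

/-- Mutually `τ`-reachable states are max-trace equivalent. -/
theorem Equiv.of_tauMany {u v : S} (huv : Δ.tauMany u v) (hvu : Δ.tauMany v u) :
    Δ.Equiv u v := by
  intro k
  induction k using Nat.strong_induction_on generalizing u v with
  | _ k ih =>
    have hk : ∀ x y, Δ.tauMany x y → Δ.tauMany y x → Δ.equivK k x y :=
      fun x y hxy hyx k' hk' => ih k' hk' hxy hyx
    exact (kTraces_subset_of_tauMany hk hvu huv).antisymm (kTraces_subset_of_tauMany hk huv hvu)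

end ObjSys

/-- Lemma 2: every transition on a `τ`-loop is a stutter step. -/
theorem stmt1 {S T M V : Type} (Δ : ObjSys S T M V) (s : S)
    (l : List (Act T M V × S)) (hne : l ≠ [])
    (hp : Δ.IsPath s l)
    (htau : ∀ p ∈ l, p.1 = (none : Act T M V))
    (hloop : (l.getLast hne).2 = s) :
    ∀ (pre post : List (Act T M V × S)) (a : Act T M V) (y : S),
      l = pre ++ (a, y) :: post → Δ.Equiv (endStateFrom s pre) y := by
  intro pre post a y hl
  have hend : endStateFrom s l = s := (endStateFrom_eq_getLast s hne).trans hloop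
  subst hl
  obtain ⟨hpre, hrest⟩ := hp.of_append
  obtain rfl : a = none := htau (a, y) (by simp)
  rw [endStateFrom_append, endStateFrom_cons] at hend
  cases hrest with
  | cons h hpost =>
    have hsu := hpre.tauMany fun p hp => htau p (by simp [hp])
    have hys := hpost.tauMany fun p hp => htau p (by simp [hp])
    rw [hend] at hys
    exact ObjSys.Equiv.of_tauMany (.single h) (hys.trans hsu)

end EffectPaper
end

section
/- The effect race relation ≪ on internal effect steps of an object system is symmetric (α ≪ β implies β ≪ α) and irreflexive (for no internal effect step α does α ≪ α hold). -/
namespace EffectPaper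

open scoped Classical

variable {S T M V : Type}

namespace ObjSys

variable {Δ : ObjSys S T M V}

theorem Equiv.refl (s : S) : Δ.Equiv s s := fun _ => rfl

theorem Equiv.symm {s r : S} (h : Δ.Equiv s r) : Δ.Equiv r s := fun k => (h k).symm

theorem stutterTau.tauMany {s r : S} (h : Δ.stutterTau s r) : Δ.tauMany s r :=
  Relation.ReflTransGen.mono (fun _ _ h => h.1) _ _ h

/-- An internal effect step is a weak internal step. -/
theorem IsEffStep.tauMany {s r : S} (h : Δ.IsEffStep s none r) : Δ.tauMany s r := by
  obtain ⟨sn, hs, ht, -⟩ := h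
  exact Relation.ReflTransGen.tail hs.tauMany ht

theorem Race.not_equiv {s r q : S} {a : Act T M V} (h : Δ.Race s r a q) : ¬ Δ.Equiv q r :=
  h.1.1.2.2

theorem Race.symm {s r q : S} (h : Δ.Race s r none q) : Δ.Race s q none r := by
  obtain ⟨⟨⟨hr, hq, hne⟩, -⟩, hdep⟩ := h
  refine ⟨⟨⟨hq, hr, fun e => hne e.symm⟩, fun l hl e => ?_⟩, fun c hc hind => ?_⟩
  · exact hdep _ ⟨s, rfl⟩ (Or.inr ⟨rfl, l, hl.tauMany, e⟩)
  · rcases hind with ⟨l₁, l₂, h₁, h₂, m₁, m₂⟩ | ⟨-, l, hl, e⟩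
    · exact hdep c hc (Or.inl ⟨l₂, l₁, h₂, h₁, m₂, m₁⟩)
    · exact hdep _ ⟨q, rfl⟩
        (Or.inl ⟨l, q, hl, Relation.ReflTransGen.refl, e.symm, Equiv.refl q⟩)

end ObjSys

/-- Theorem 3 (1),(2): the effect race relation on internal effect
steps is symmetric and irreflexive. -/
theorem stmt4 {S T M V : Type} (Δ : ObjSys S T M V) :
    (∀ s r q : S, Δ.IsEffStep s none r → Δ.IsEffStep s none q →
        Δ.Race s r none q → Δ.Race s q none r) ∧
    (∀ s r : S, Δ.IsEffStep s none r → ¬ Δ.Race s r none r) :=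
  ⟨fun _ _ _ _ _ h => h.symm, fun _ r _ h => h.not_equiv (ObjSys.Equiv.refl r)⟩

end EffectPaper
end

section
/- The effect race relation ≪ is not transitive: there exist an object system and internal effect steps α, β, μ such that α ≪ β and β ≪ μ but not α ≪ μ. -/
namespace EffectPaper

open scoped Classical

variable {S T M V : Type}

theorem filterMap_fst_compress (X : Set S) (L : List (Act T M V × Set S)) :
    (compress X L).filterMap Prod.fst = L.filterMap Prod.fst := by
  induction L generalizing X with
  | nil => rfl
  | cons p L ih =>
    obtain ⟨a, Y⟩ := p
    by_cases h : a = none ∧ X = Y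
    · simp [compress, h, ih]
    · simp [compress, h, ih, List.filterMap_cons]

namespace ObjSys

/-- Effect equivalent states have the same traces. -/
theorem Equiv.exists_path_traceOf_eq {Δ : ObjSys S T M V} {x y : S} (h : Δ.Equiv x y)
    {l : List (Act T M V × S)} (hl : Δ.IsPath x l) :
    ∃ l', Δ.IsPath y l' ∧ traceOf l' = traceOf l := by
  have h0 := h 0
  rw [kTraces] at h0
  obtain ⟨l', hl', e⟩ := (Set.ext_iff.mp h0 _).mp ⟨l, hl, rfl⟩
  refine ⟨l', hl', ?_⟩
  have e' := congrArg (fun p => p.2.filterMap Prod.fst) e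
  simp only [filterMap_fst_compress, List.filterMap_map] at e'
  exact e'.symm

/-- The object system with internal transitions `step` in which every state announces itself
by a visible self-loop. -/
def announcing (step : S → S → Prop) (s₀ : S) : ObjSys S Unit Unit S where
  tr x a y := match a with
    | none => step x y
    | some e => e = .call () () x ∧ y = x
  init := s₀

theorem tauMany_announcing_of_traceOf {step : S → S → Prop} {s₀ y v : S}
    {l : List (Act Unit Unit S × S)} (hl : (announcing step s₀).IsPath y l)
    (ht : traceOf l = [.call () () v]) : (announcing step s₀).tauMany y v := by
  induction hl with
  | nil => simp [traceOf] at ht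
  | @cons x x' a l h _ ih =>
    cases a with
    | none => exact .head h (ih (by simpa [traceOf] using ht))
    | some e =>
      obtain ⟨rfl, -⟩ := h
      simp only [traceOf, List.filterMap_cons, List.cons.injEq, Ev.call.injEq, true_and] at ht
      obtain ⟨rfl, -⟩ := ht
      exact .refl

theorem Equiv.tauMany_announcing {step : S → S → Prop} {s₀ x y : S}
    (h : (announcing step s₀).Equiv x y) : (announcing step s₀).tauMany y x := by
  obtain ⟨l, hl, ht⟩ := h.exists_path_traceOf_eq
    (l := [(some (.call () () x), x)]) (.cons ⟨rfl, rfl⟩ (.nil x))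
  exact tauMany_announcing_of_traceOf hl ht

theorem tauMany_announcing_le [Preorder S] {step : S → S → Prop} {s₀ x y : S}
    (hstep : ∀ x y, step x y → y < x) (h : (announcing step s₀).tauMany x y) : y ≤ x := by
  induction h with
  | refl => exact le_rfl
  | tail _ h ih => exact (hstep _ _ h).le.trans ih

theorem equiv_announcing_iff [PartialOrder S] {step : S → S → Prop} {s₀ x y : S}
    (hstep : ∀ x y, step x y → y < x) : (announcing step s₀).Equiv x y ↔ x = y := by
  refine ⟨fun h => le_antisymm ?_ ?_, ?_⟩
  · exact tauMany_announcing_le hstep h.tauMany_announcing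
  · exact tauMany_announcing_le hstep (Equiv.tauMany_announcing fun k => (h k).symm)
  · rintro rfl _
    rfl

theorem isEffStep_announcing_iff [PartialOrder S] {step : S → S → Prop} {s₀ x y : S}
    (hstep : ∀ x y, step x y → y < x) :
    (announcing step s₀).IsEffStep x none y ↔ step x y := by
  constructor
  · rintro ⟨z, hz, h, -⟩
    have : x = z := by
      induction hz with
      | refl => rfl
      | tail _ hτ _ => exact absurd ((equiv_announcing_iff hstep).mp hτ.2) (hstep _ _ hτ.1).ne'
    exact this ▸ h
  · exact fun h => ⟨x, .refl, h, fun e => (hstep _ _ h).ne' ((equiv_announcing_iff hstep).mp e)⟩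

/-- In an announcing system, two internal steps to states without a common internal successor
race. -/
theorem race_announcing [PartialOrder S] {step : S → S → Prop} {s₀ s r q : S}
    (hstep : ∀ x y, step x y → y < x) (hr : step s r) (hq : step s q)
    (hrq : ∀ l, (announcing step s₀).tauMany r l → ¬ (announcing step s₀).tauMany q l) :
    (announcing step s₀).Race s r none q := by
  have hE {x y : S} := equiv_announcing_iff (s₀ := s₀) (x := x) (y := y) hstep
  have hI {x y : S} := isEffStep_announcing_iff (s₀ := s₀) (x := x) (y := y) hstep
  refine ⟨⟨⟨hI.mpr hr, hI.mpr hq, fun e => ?_⟩, fun l hl e => ?_⟩, ?_⟩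
  · obtain rfl := hE.mp e
    exact hrq _ .refl .refl
  · obtain rfl := hE.mp e
    exact hrq _ (.single (hI.mp hl)) .refl
  · rintro _ ⟨c, rfl⟩ (⟨l₁, l₂, h₁, h₂, e₁, e₂⟩ | ⟨-, l, hl, e⟩)
    · obtain rfl := hE.mp e₁
      obtain rfl := hE.mp e₂
      exact hrq _ h₁ h₂
    · obtain rfl := hE.mp e
      exact hrq _ .refl hl

end ObjSys

/-- Internal transitions `3 → 0`, `3 → 1`, `3 → 2` and `2 → 1`: the steps from `3` to `1` and to
`2` both race with the step to `0`, but not with each other. -/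
def forkStep (x y : Fin 4) : Prop := (x = 3 ∧ y < 3) ∨ (x = 2 ∧ y = 1)

theorem forkStep_lt (x y : Fin 4) (h : forkStep x y) : y < x := by
  rcases h with ⟨rfl, h⟩ | ⟨rfl, rfl⟩
  · exact h
  · decide

theorem not_tauMany_forkStep_zero {x l : Fin 4} (hx : x = 1 ∨ x = 2)
    (h : (ObjSys.announcing forkStep 3).tauMany x l) :
    ¬ (ObjSys.announcing forkStep 3).tauMany 0 l := by
  have hl : l = 1 ∨ l = 2 := by
    induction h with
    | refl => exact hx
    | tail _ h ih =>
      rcases h with ⟨rfl, -⟩ | ⟨-, rfl⟩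
      · exact absurd ih (by decide)
      · exact .inl rfl
  intro h0
  have := ObjSys.tauMany_announcing_le forkStep_lt h0
  rcases hl with rfl | rfl <;> exact absurd this (by decide)

/-- Theorem 3 (3): the effect race relation is not transitive. -/
theorem stmt5 :
    ∃ (S T M V : Type) (Δ : ObjSys S T M V) (s r q u : S),
      Δ.IsEffStep s none r ∧ Δ.IsEffStep s none q ∧ Δ.IsEffStep s none u ∧
      Δ.Race s r none q ∧ Δ.Race s q none u ∧ ¬ Δ.Race s r none u := by
  have hstep (x : Fin 4) (hx : x < 3) : forkStep 3 x := .inl ⟨rfl, hx⟩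
  refine ⟨Fin 4, Unit, Unit, Fin 4, ObjSys.announcing forkStep 3, 3, 1, 0, 2,
    (ObjSys.isEffStep_announcing_iff forkStep_lt).mpr (hstep 1 (by decide)),
    (ObjSys.isEffStep_announcing_iff forkStep_lt).mpr (hstep 0 (by decide)),
    (ObjSys.isEffStep_announcing_iff forkStep_lt).mpr (hstep 2 (by decide)),
    ObjSys.race_announcing forkStep_lt (hstep 1 (by decide)) (hstep 0 (by decide))
      fun _ => not_tauMany_forkStep_zero (.inl rfl),
    ObjSys.race_announcing forkStep_lt (hstep 0 (by decide)) (hstep 2 (by decide))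
      fun _ h0 h2 => not_tauMany_forkStep_zero (.inr rfl) h2 h0,
    fun h => h.2 _ ⟨1, rfl⟩ (.inr ⟨rfl, 1, .single ?_, fun _ => rfl⟩)⟩
  exact .inr ⟨rfl, rfl⟩

end EffectPaper
end
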